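/- arXiv:2402.15669 — 2 statements merged into one kernel-verified Lean document; each statement's English description precedes it below -/
import Mathlib

section
/- Let G be a simple graph, let v be a vertex of G with degree d(v), and let S be a nonempty proper subset of V(G) with v ∉ S. Then per L_S(G) = d(v)·per L_{S∪{v}}(G) + Σ_{u∈N(v), u∉S} per L_{S∪{u,v}}(G) + 2·Σ_{C∈𝒞_G(v), V(C)∩S=∅} (−1)^{|V(C)|}·per L_{V(C)∪S}(G), where N(v) is the neighborhood of v and 𝒞_G(v) is the set of cycles of G (as subgraphs) passing through v. -/
open scoped Classical

/-- Permanent of the Laplacian matrix of `G` (over `ℝ`). -/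
noncomputable def permL {V : Type*} [Fintype V] (G : SimpleGraph V) : ℝ :=
  (G.lapMatrix ℝ).permanent

/-- Permanent of the principal submatrix of the Laplacian of `G` obtained by deleting the
rows and columns indexed by vertices in `S`. -/
noncomputable def permDel {V : Type*} [Fintype V] (G : SimpleGraph V) (S : Set V) : ℝ :=
  ((G.lapMatrix ℝ).submatrix (fun i : ↥(Sᶜ) => (i : V)) (fun i : ↥(Sᶜ) => (i : V))).permanent

/-- A subgraph is a cycle subgraph if it is the subgraph traced out by some cycle walk. -/
def IsCycleSubgraph {V : Type*} (G : SimpleGraph V) (C : G.Subgraph) : Prop :=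
  ∃ (x : V) (w : G.Walk x x), w.IsCycle ∧ w.toSubgraph = C

section Permanent

open Finset Equiv.Perm

variable {V R : Type*} [Fintype V] [CommSemiring R]

/-- The permanent of `M` with the rows and columns in `T` deleted, written as a sum over the
permutations of the whole index type that fix `T` pointwise. -/
noncomputable def Matrix.permanentCompl (M : Matrix V V R) (T : Set V) : R :=
  ∑ σ : Equiv.Perm V with ∀ x ∈ T, σ x = x, ∏ i with i ∉ T, M (σ i) i

theorem permanent_submatrix_compl (M : Matrix V V R) (T : Set V) :
    (M.submatrix (fun i : ↥(Tᶜ) => (i : V)) (fun i : ↥(Tᶜ) => (i : V))).permanent =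
      M.permanentCompl T := by
  rw [Matrix.permanentCompl, Matrix.permanent, ← Finset.sum_subtype_eq_sum_filter, Finset.subtype_univ]
  refine Fintype.sum_equiv ((Equiv.Perm.subtypeEquivSubtypePerm (· ∈ Tᶜ)).trans
    (Equiv.subtypeEquivRight fun σ => by simp)) _ _ fun σ => ?_
  rw [← Finset.prod_subtype_eq_prod_filter, Finset.subtype_univ]
  refine Fintype.prod_equiv (Equiv.refl _) _ _ fun i => ?_
  have := Equiv.Perm.subtypeEquivSubtypePerm_apply_of_mem σ i.2
  simp only [Matrix.submatrix_apply, Equiv.refl_apply]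
  exact congrArg (M · i) this.symm

/-- The permutations fixing `S` whose cycle through `v` is `c` are the products of `c` with a
permutation fixing both `S` and the cycle. -/
theorem sum_cycleOf_eq (M : Matrix V V R) (S : Set V) (v : V) (hv : v ∉ S) (c : Equiv.Perm V)
    (hc : c.cycleOf v = c) (hcS : ∀ x ∈ S, c x = x) :
    ∑ σ : Equiv.Perm V with (∀ x ∈ S, σ x = x) ∧ σ.cycleOf v = c, ∏ i with i ∉ S, M (σ i) i =
      (∏ i ∈ insert v c.support, M (c i) i) *
        M.permanentCompl (S ∪ insert v ↑c.support) := by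
  rw [Matrix.permanentCompl, Finset.mul_sum]
  symm
  refine Finset.sum_bij' (fun τ _ => c * τ) (fun σ _ => c⁻¹ * σ) ?_ ?_ ?_ ?_ ?_
  · intro τ hτ
    simp only [mem_filter, mem_univ, true_and, Set.mem_union, Set.mem_insert_iff, mem_coe,
      Equiv.Perm.mem_support] at hτ ⊢
    refine ⟨fun x hx => by simp [hτ x (.inl hx), hcS x hx], ?_⟩
    have hd : c.Disjoint τ := fun x => by
      by_cases h : c x = x
      · exact .inl h
      · exact .inr (hτ x (.inr (.inr h)))
    rw [hd.cycleOf_mul_distrib, hc, (cycleOf_eq_one_iff τ).2 (hτ v (.inr (.inl rfl))), mul_one]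
  · intro σ hσ
    simp only [mem_filter, mem_univ, true_and] at hσ ⊢
    obtain ⟨h1, h2⟩ := hσ
    have key : ∀ x, σ.SameCycle v x → (c⁻¹ * σ) x = x := fun x hx => by
      rw [Equiv.Perm.mul_apply, Equiv.Perm.inv_eq_iff_eq, ← h2, hx.cycleOf_apply]
    rintro x (hx | rfl | hx)
    · rw [Equiv.Perm.mul_apply, h1 x hx, Equiv.Perm.inv_eq_iff_eq, hcS x hx]
    · exact key _ (SameCycle.refl _ _)
    · rw [mem_coe, ← h2, mem_support_cycleOf_iff] at hx
      exact key _ hx.1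
  · intro τ _; simp
  · intro σ _; simp
  · intro τ hτ
    simp only [mem_filter, mem_univ, true_and] at hτ
    have hsub : insert v c.support ⊆ univ.filter (· ∉ S) := by
      intro x hx
      simp only [mem_filter, mem_univ, true_and]
      intro hxS
      rcases mem_insert.1 hx with rfl | hx
      · exact hv hxS
      · exact (Equiv.Perm.mem_support.1 hx) (hcS x hxS)
    rw [← Finset.prod_sdiff hsub, mul_comm]
    congr 1
    · refine prod_congr (by ext x; simp only [Set.mem_union, Set.mem_insert_iff, mem_coe,
        mem_filter, mem_univ, true_and, mem_sdiff, mem_insert]; tauto) fun i hi => ?_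
      have hi' : c (τ i) = τ i := by
        by_contra h
        have h2 := τ.injective (hτ (τ i) (.inr (.inr (by simpa using h))))
        rw [h2] at h
        simp only [mem_sdiff, mem_insert, Equiv.Perm.mem_support, not_or] at hi
        exact hi.2.2 h
      rw [Equiv.Perm.mul_apply, hi']
    · refine prod_congr rfl fun i hi => ?_
      rw [Equiv.Perm.mul_apply, hτ i (.inr (by simpa using hi))]

theorem permanentCompl_eq_sum_cycles (M : Matrix V V R) (S : Set V) (v : V) (hv : v ∉ S) :
    M.permanentCompl S =
      ∑ c : Equiv.Perm V with c.cycleOf v = c ∧ ∀ x ∈ S, c x = x,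
        (∏ i ∈ insert v c.support, M (c i) i) *
          M.permanentCompl (S ∪ insert v ↑c.support) := by
  rw [Matrix.permanentCompl,
    ← Finset.sum_fiberwise_of_maps_to (g := fun σ : Equiv.Perm V => σ.cycleOf v)
      (t := univ.filter fun c : Equiv.Perm V => c.cycleOf v = c ∧ ∀ x ∈ S, c x = x)]
  · refine sum_congr rfl fun c hc => ?_
    simp only [mem_filter, mem_univ, true_and] at hc
    rw [Finset.filter_filter, sum_cycleOf_eq M S v hv c hc.1 hc.2]
  · intro σ hσ
    simp only [mem_filter, mem_univ, true_and] at hσ ⊢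
    refine ⟨?_, fun x hx => ?_⟩
    · by_cases h : σ v = v
      · rw [(cycleOf_eq_one_iff σ).2 h, cycleOf_one]
      · exact (σ.isCycle_cycleOf h).cycleOf_eq (by rwa [cycleOf_apply_self])
    · rw [cycleOf_apply]
      split_ifs
      · exact hσ x hx
      · rfl

end Permanent

section CyclePerm

open Equiv.Perm

variable {V : Type*} {G : SimpleGraph V}

/-- The subgraph of `G` whose vertices are the points moved by `c` and whose edges are the edges
of `G` joining a point to its image under `c`. -/
def cyclePermSubgraph (G : SimpleGraph V) (c : Equiv.Perm V) : G.Subgraph where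
  verts := {x | c x ≠ x}
  Adj a b := G.Adj a b ∧ (c a = b ∨ c b = a)
  adj_sub h := h.1
  edge_vert := by
    rintro a b ⟨h, rfl | hb⟩ ha
    · exact h.ne ha.symm
    · exact h.ne (c.injective (ha.trans hb.symm))
  symm := ⟨fun _ _ h => ⟨h.1.symm, h.2.symm⟩⟩

theorem cyclePermSubgraph_inv (c : Equiv.Perm V) :
    cyclePermSubgraph G c⁻¹ = cyclePermSubgraph G c := by
  ext a b
  · change c⁻¹ a ≠ a ↔ c a ≠ a
    rw [Ne, Equiv.Perm.inv_eq_iff_eq, eq_comm]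
  · simp only [cyclePermSubgraph, Equiv.Perm.inv_eq_iff_eq]
    rw [eq_comm (a := a), eq_comm (a := b), or_comm]

theorem cyclePermSubgraph_eq_toSubgraph {x : V} (w : G.Walk x x) (c : Equiv.Perm V)
    (hw : 0 < w.length) (h : ∀ i < w.length, c (w.getVert i) = w.getVert (i + 1))
    (hfix : ∀ y ∉ w.support, c y = y) : cyclePermSubgraph G c = w.toSubgraph := by
  have hmem : ∀ y ∈ w.support, ∃ i < w.length, w.getVert i = y := by
    intro y hy
    obtain ⟨i, hi, hle⟩ := SimpleGraph.Walk.mem_support_iff_exists_getVert.1 hy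
    rcases hle.lt_or_eq with hlt | rfl
    · exact ⟨i, hlt, hi⟩
    · exact ⟨0, hw, by rw [← hi]; simp⟩
  have hadj : ∀ a b, G.Adj a b → c a = b →
      ∃ i, s(w.getVert i, w.getVert (i + 1)) = s(a, b) ∧ i < w.length := by
    rintro a b hab rfl
    have : a ∈ w.support := by
      by_contra hn
      exact hab.ne (hfix a hn).symm
    obtain ⟨i, hi, rfl⟩ := hmem a this
    exact ⟨i, by rw [h i hi], hi⟩
  ext a b
  · rw [SimpleGraph.Walk.mem_verts_toSubgraph]
    refine ⟨fun ha => by_contra fun hn => ha (hfix a hn), fun ha => ?_⟩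
    obtain ⟨i, hi, rfl⟩ := hmem a ha
    change c _ ≠ _
    rw [h i hi]
    exact (w.adj_getVert_succ hi).ne'
  · rw [SimpleGraph.Walk.toSubgraph_adj_iff]
    constructor
    · rintro ⟨hab, hc | hc⟩
      · exact hadj a b hab hc
      · rw [Sym2.eq_swap]
        exact hadj b a hab.symm hc
    · rintro ⟨i, he, hi⟩
      have hadj' := w.adj_getVert_succ hi
      rcases Sym2.eq_iff.1 he with ⟨rfl, rfl⟩ | ⟨rfl, rfl⟩
      · exact ⟨hadj', .inl (h i hi)⟩
      · exact ⟨hadj'.symm, .inr (h i hi)⟩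

theorem exists_walk_getVert_eq_pow (c : Equiv.Perm V) (v : V)
    (h : ∀ n : ℕ, G.Adj ((c ^ n) v) ((c ^ (n + 1)) v)) (n : ℕ) :
    ∃ w : G.Walk v ((c ^ n) v), w.length = n ∧ ∀ i ≤ n, w.getVert i = (c ^ i) v := by
  have hchain : ((List.range (n + 1)).map fun i => (c ^ i) v).IsChain G.Adj := by
    rw [List.isChain_iff_getElem]
    intro i hi
    simpa using h i
  have hne : ((List.range (n + 1)).map fun i => (c ^ i) v) ≠ [] := by simp
  refine ⟨(SimpleGraph.Walk.ofSupport _ hne hchain).copy (by simp) (by simp), by simp, ?_⟩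
  intro i hi
  rw [SimpleGraph.Walk.getVert_copy]
  refine (SimpleGraph.Walk.support_getElem_eq_getVert (n := i) _
    (by simpa using Nat.lt_succ_of_le hi)).symm.trans ?_
  simp

variable [Fintype V]

theorem Equiv.Perm.IsCycle.apply_apply_ne {c : Equiv.Perm V} (hc : c.IsCycle)
    (h3 : 3 ≤ c.support.card) {y : V} (hy : c y ≠ y) : c (c y) ≠ y := by
  intro h
  have h2 : c ^ 2 = c ^ 0 := hc.pow_eq_pow_iff.2 ⟨y, hy, by simpa [sq] using h⟩
  have := Nat.le_of_dvd two_pos (orderOf_dvd_of_pow_eq_one (h2.trans (pow_zero c)))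
  rw [hc.orderOf] at this
  omega

theorem isCycleSubgraph_cyclePermSubgraph {c : Equiv.Perm V} (hc : c.IsCycle)
    (h3 : 3 ≤ c.support.card) (hadj : ∀ x ∈ c.support, G.Adj (c x) x) :
    IsCycleSubgraph G (cyclePermSubgraph G c) := by
  obtain ⟨v, hv, hsame⟩ := id hc
  obtain ⟨w, hlen, hget⟩ := exists_walk_getVert_eq_pow (G := G) c v (fun n => by
    rw [pow_succ', Equiv.Perm.mul_apply]
    exact (hadj _ (by rw [Equiv.Perm.pow_apply_mem_support]; simpa using hv)).symm)
    c.support.card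
  have hpow : (c ^ c.support.card) v = v := by rw [← hc.orderOf, pow_orderOf_eq_one]; rfl
  have hinj : ∀ i < c.support.card, ∀ j < c.support.card, (c ^ i) v = (c ^ j) v → i = j := by
    intro i hi j hj hij
    rw [← hc.orderOf] at hi hj
    exact pow_injOn_Iio_orderOf hi hj (hc.pow_eq_pow_iff.2 ⟨v, hv, hij⟩)
  refine ⟨v, w.copy rfl hpow, ?_, ?_⟩
  · rw [SimpleGraph.Walk.isCycle_iff_isPath_tail_and_le_length]
    refine ⟨?_, by simpa [hlen] using h3⟩
    rw [← SimpleGraph.Walk.IsPath.getVert_injOn_iff]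
    intro i hi j hj hij
    simp only [Set.mem_ofPred_eq, SimpleGraph.Walk.length_tail,
      SimpleGraph.Walk.length_copy, hlen] at hi hj
    rw [SimpleGraph.Walk.getVert_tail, SimpleGraph.Walk.getVert_tail,
      SimpleGraph.Walk.getVert_copy, SimpleGraph.Walk.getVert_copy, hget _ (by omega),
      hget _ (by omega), pow_succ', pow_succ', Equiv.Perm.mul_apply, Equiv.Perm.mul_apply,
      c.injective.eq_iff] at hij
    exact hinj i (by omega) j (by omega) hij
  · symm
    apply cyclePermSubgraph_eq_toSubgraph
    · rw [SimpleGraph.Walk.length_copy, hlen]; omega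
    · intro i hi
      rw [SimpleGraph.Walk.length_copy, hlen] at hi
      rw [SimpleGraph.Walk.getVert_copy, SimpleGraph.Walk.getVert_copy, hget _ hi.le,
        hget _ hi, pow_succ', Equiv.Perm.mul_apply]
    · intro y hy
      by_contra hne
      obtain ⟨i, hi, rfl⟩ := (hsame hne).exists_pow_eq'
      rw [hc.orderOf] at hi
      apply hy
      rw [SimpleGraph.Walk.support_copy, SimpleGraph.Walk.mem_support_iff_exists_getVert]
      exact ⟨i, hget i hi.le, by omega⟩

theorem SimpleGraph.Walk.IsCycle.exists_cyclePermSubgraph_eq {x : V} {w : G.Walk x x}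
    (hw : w.IsCycle) : ∃ c : Equiv.Perm V, c.IsCycle ∧ 3 ≤ c.support.card ∧
      (∀ x ∈ c.support, G.Adj (c x) x) ∧ cyclePermSubgraph G c = w.toSubgraph := by
  have h3 := hw.three_le_length
  set l := w.support.dropLast with hl
  have hnd : l.Nodup := hw.nodup_dropLast_support
  have hlen : l.length = w.length := by simp [hl]
  have hget : ∀ i (hi : i < l.length), l[i] = w.getVert i := by
    intro i hi
    simp only [hl, List.getElem_dropLast]
    exact SimpleGraph.Walk.support_getElem_eq_getVert _ _
  have hsupp : l.formPerm.support = l.toFinset :=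
    List.support_formPerm_of_nodup l hnd (by rintro y hy; rw [hy] at hlen; simp at hlen; omega)
  have hstep : ∀ i < w.length, l.formPerm (w.getVert i) = w.getVert (i + 1) := by
    intro i hi
    rw [← hget i (hlen ▸ hi), List.formPerm_apply_getElem l hnd i (hlen ▸ hi), hget, hlen]
    rcases Nat.lt_or_ge (i + 1) w.length with h | h
    · rw [Nat.mod_eq_of_lt h]
    · have hlast : i + 1 = w.length := by omega
      simp [hlast]
  refine ⟨l.formPerm, List.isCycle_formPerm hnd (by omega), ?_, ?_, ?_⟩
  · rw [hsupp, List.toFinset_card_of_nodup hnd, hlen]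
    exact h3
  · intro y hy
    rw [hsupp, List.mem_toFinset] at hy
    obtain ⟨i, hi, rfl⟩ := List.getElem_of_mem hy
    rw [hget i hi, hstep i (hlen ▸ hi)]
    exact (w.adj_getVert_succ (hlen ▸ hi)).symm
  · refine cyclePermSubgraph_eq_toSubgraph w _ (by omega) hstep fun y hy => ?_
    exact List.formPerm_apply_of_notMem fun h => hy (List.mem_of_mem_dropLast h)

theorem Equiv.Perm.IsCycle.eq_of_apply_eq {c d : Equiv.Perm V} (hd : d.IsCycle)
    (h3 : 3 ≤ d.support.card) (hfix : ∀ a, d a = a → c a = a)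
    (h : ∀ a, d a ≠ a → d a = c a ∨ c (d a) = a) {v : V} (hv : d v ≠ v) (hvc : d v = c v) :
    d = c := by
  have key : ∀ n : ℕ, d ((d ^ n) v) = c ((d ^ n) v) := by
    intro n
    induction n with
    | zero => exact hvc
    | succ n ih =>
      have hy : d ((d ^ n) v) ≠ (d ^ n) v := by
        rwa [← Equiv.Perm.mem_support, Equiv.Perm.pow_apply_mem_support, Equiv.Perm.mem_support]
      rw [pow_succ', Equiv.Perm.mul_apply]
      rcases h _ (d.injective.ne hy) with h1 | h1
      · exact h1
      · rw [ih] at h1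
        exact absurd (ih ▸ c.injective h1) (hd.apply_apply_ne h3 hy)
  ext a
  by_cases ha : d a = a
  · rw [ha, hfix a ha]
  · obtain ⟨i, rfl⟩ := hd.exists_pow_eq hv ha
    exact key i

theorem eq_or_eq_inv_of_cyclePermSubgraph_eq {c d : Equiv.Perm V} (hd : d.IsCycle)
    (h3 : 3 ≤ d.support.card) (hadj : ∀ x ∈ d.support, G.Adj (d x) x)
    (h : cyclePermSubgraph G d = cyclePermSubgraph G c) : d = c ∨ d = c⁻¹ := by
  have hfix : ∀ a, d a = a ↔ c a = a := fun a =>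
    not_iff_not.1 (Set.ext_iff.1 (congrArg SimpleGraph.Subgraph.verts h) a)
  have hnext : ∀ a, d a ≠ a → d a = c a ∨ c (d a) = a := fun a ha => by
    have h1 : (cyclePermSubgraph G d).Adj a (d a) :=
      ⟨(hadj a (Equiv.Perm.mem_support.2 ha)).symm, .inl rfl⟩
    rw [h] at h1
    exact h1.2.imp_left Eq.symm
  obtain ⟨v, hv, -⟩ := id hd
  rcases hnext v hv with hvc | hvc
  · exact .inl (hd.eq_of_apply_eq h3 (fun a => (hfix a).1) hnext hv hvc)
  · refine .inr (hd.eq_of_apply_eq h3 (fun a ha => ?_) (fun a ha => ?_) hv ?_)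
    · rw [Equiv.Perm.inv_eq_iff_eq, (hfix a).1 ha]
    · rw [Equiv.Perm.eq_inv_iff_eq, Equiv.Perm.inv_eq_iff_eq]
      exact (hnext a ha).symm
    · rwa [Equiv.Perm.eq_inv_iff_eq]

end CyclePerm

section Laplacian

open Finset Equiv.Perm

variable {V : Type*} [Fintype V]

theorem permDel_eq_permanentCompl (G : SimpleGraph V) (T : Set V) :
    permDel G T = (G.lapMatrix ℝ).permanentCompl T :=
  permanent_submatrix_compl _ _

theorem lapMatrix_apply_self (G : SimpleGraph V) (v : V) : G.lapMatrix ℝ v v = G.degree v := by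
  simp [SimpleGraph.lapMatrix, SimpleGraph.degMatrix]

theorem lapMatrix_apply_of_ne (G : SimpleGraph V) {a b : V} (h : a ≠ b) :
    G.lapMatrix ℝ a b = if G.Adj a b then -1 else 0 := by
  by_cases hab : G.Adj a b <;> simp [SimpleGraph.lapMatrix, SimpleGraph.degMatrix, h, hab]

theorem prod_support_lapMatrix (G : SimpleGraph V) (c : Equiv.Perm V) :
    ∏ i ∈ c.support, G.lapMatrix ℝ (c i) i =
      if ∀ x ∈ c.support, G.Adj (c x) x then (-1) ^ c.support.card else 0 := by
  rw [prod_congr rfl fun i hi => lapMatrix_apply_of_ne G (Equiv.Perm.mem_support.1 hi)]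
  split_ifs with h
  · rw [← prod_const]
    exact prod_congr rfl fun i hi => if_pos (h i hi)
  · push Not at h
    obtain ⟨x, hx, hn⟩ := h
    exact prod_eq_zero hx (if_neg hn)

/-- The cyclic permutations through `v` that fix `S` pointwise. -/
noncomputable def cyclesThrough (v : V) (S : Set V) : Finset (Equiv.Perm V) :=
  univ.filter fun c => c.IsCycle ∧ v ∈ c.support ∧ ∀ x ∈ S, c x = x

theorem permDel_eq_sum_cyclesThrough (G : SimpleGraph V) (v : V) (S : Set V) (hv : v ∉ S) :
    permDel G S = G.degree v * permDel G (S ∪ {v}) +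
      ∑ c ∈ cyclesThrough v S, if ∀ x ∈ c.support, G.Adj (c x) x then
        (-1) ^ c.support.card * permDel G (c.support ∪ S) else 0 := by
  have hset : (univ.filter fun c : Equiv.Perm V => c.cycleOf v = c ∧ ∀ x ∈ S, c x = x) =
      insert 1 (cyclesThrough v S) := by
    ext c
    simp only [cyclesThrough, mem_filter, mem_univ, true_and, mem_insert]
    constructor
    · rintro ⟨h1, h2⟩
      by_cases hcv : c v = v
      · exact .inl (h1 ▸ (cycleOf_eq_one_iff c).2 hcv)
      · exact .inr ⟨h1 ▸ c.isCycle_cycleOf hcv, Equiv.Perm.mem_support.2 hcv, h2⟩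
    · rintro (rfl | ⟨h1, h2, h3⟩)
      · simp
      · exact ⟨h1.cycleOf_eq (Equiv.Perm.mem_support.1 h2), h3⟩
  rw [permDel_eq_permanentCompl, permanentCompl_eq_sum_cycles _ S v hv, hset,
    sum_insert (by simp [cyclesThrough])]
  congr 1
  · simp [lapMatrix_apply_self, permDel_eq_permanentCompl]
  · refine sum_congr rfl fun c hc => ?_
    simp only [cyclesThrough, mem_filter, mem_univ, true_and] at hc
    rw [insert_eq_self.2 hc.2.1, Set.insert_eq_of_mem (mem_coe.2 hc.2.1), Set.union_comm,
      prod_support_lapMatrix, ite_mul, zero_mul, permDel_eq_permanentCompl]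

theorem sum_cyclesThrough_two (G : SimpleGraph V) (v : V) (S : Set V) (hv : v ∉ S) :
    ∑ c ∈ cyclesThrough v S with c.support.card = 2,
        (if ∀ x ∈ c.support, G.Adj (c x) x then
          (-1) ^ c.support.card * permDel G (c.support ∪ S) else 0) =
      ∑ᶠ u ∈ {u | u ∈ G.neighborSet v ∧ u ∉ S}, permDel G (S ∪ {u, v}) := by
  rw [finsum_mem_eq_finite_toFinset_sum _ (Set.toFinite _)]
  symm
  refine sum_of_injOn (fun u => Equiv.swap v u) ?_ ?_ ?_ ?_
  · intro a _ b _ hab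
    simpa using congrArg (fun c : Equiv.Perm V => c v) hab
  · intro u hu
    simp only [Set.Finite.coe_toFinset, Set.mem_ofPred_eq, SimpleGraph.mem_neighborSet] at hu
    have hne := hu.1.ne
    simp only [coe_filter, cyclesThrough, mem_filter, mem_univ, true_and, Set.mem_ofPred_eq]
    refine ⟨⟨isCycle_swap hne, by simp [hne.symm], fun x hx => ?_⟩, card_support_swap hne⟩
    exact Equiv.swap_apply_of_ne_of_ne (fun h => hv (h ▸ hx)) (fun h => hu.2 (h ▸ hx))
  · intro c hc himg
    simp only [cyclesThrough, mem_filter, mem_univ, true_and] at hc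
    obtain ⟨⟨-, hvc, hfix⟩, h2⟩ := hc
    refine if_neg fun hadj => himg ⟨c v, ?_, ?_⟩
    · simp only [Set.Finite.coe_toFinset, Set.mem_ofPred_eq, SimpleGraph.mem_neighborSet]
      exact ⟨(hadj v hvc).symm, fun h =>
        Equiv.Perm.mem_support.1 hvc (c.injective (hfix _ h))⟩
    · obtain ⟨x, y, hxy, rfl⟩ := card_support_eq_two.1 h2
      rw [support_swap hxy, mem_insert, mem_singleton] at hvc
      rcases hvc with rfl | rfl
      · simp
      · simp [Equiv.swap_comm]
  · intro u hu
    simp only [Set.Finite.mem_toFinset, Set.mem_ofPred_eq, SimpleGraph.mem_neighborSet] at hu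
    have hne := hu.1.ne
    rw [if_pos, card_support_swap hne, support_swap hne, Set.union_comm, Set.pair_comm]
    · simp
    · simp [support_swap hne, hu.1, hu.1.symm]

theorem sum_cyclesThrough_three_le (G : SimpleGraph V) (v : V) (S : Set V) :
    ∑ c ∈ cyclesThrough v S with ¬ c.support.card = 2,
        (if ∀ x ∈ c.support, G.Adj (c x) x then
          (-1) ^ c.support.card * permDel G (c.support ∪ S) else 0) =
      2 * ∑ᶠ C ∈ {C : G.Subgraph |
            IsCycleSubgraph G C ∧ v ∈ C.verts ∧ C.verts ∩ S = ∅},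
          (-1 : ℝ) ^ C.verts.ncard * permDel G (C.verts ∪ S) := by
  have hverts : ∀ c : Equiv.Perm V, (cyclePermSubgraph G c).verts = c.support := fun c => by
    ext x
    exact Equiv.Perm.mem_support.symm
  rw [finsum_mem_eq_finite_toFinset_sum _ (Set.toFinite _), ← sum_filter, filter_filter,
    mul_sum, ← sum_fiberwise_of_maps_to (g := cyclePermSubgraph G)]
  · refine sum_congr rfl fun C hC => ?_
    simp only [Set.Finite.mem_toFinset, Set.mem_ofPred_eq] at hC
    obtain ⟨⟨x, w, hw, rfl⟩, hvC, hCS⟩ := hC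
    obtain ⟨c, hc, h3, hadj, hcw⟩ := hw.exists_cyclePermSubgraph_eq
    rw [← hcw] at hvC hCS ⊢
    rw [hverts] at hvC hCS
    have hfiber : ((cyclesThrough v S).filter fun d => ¬ d.support.card = 2 ∧
        ∀ x ∈ d.support, G.Adj (d x) x).filter
          (fun d => cyclePermSubgraph G d = cyclePermSubgraph G c) = {c, c⁻¹} := by
      ext d
      simp only [cyclesThrough, mem_filter, mem_univ, true_and, mem_insert, mem_singleton]
      have hcfix : ∀ x ∈ S, c x = x := fun x hx => by
        by_contra hn
        have : x ∈ (c.support : Set V) ∩ S := ⟨by simpa using hn, hx⟩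
        simp [hCS] at this
      constructor
      · rintro ⟨⟨⟨hd, -, -⟩, hd2, hdadj⟩, hdc⟩
        have := hd.two_le_card_support
        exact eq_or_eq_inv_of_cyclePermSubgraph_eq hd (by omega) hdadj hdc
      · rintro (rfl | rfl)
        · exact ⟨⟨⟨hc, hvC, hcfix⟩, by omega, hadj⟩, rfl⟩
        · refine ⟨⟨⟨hc.inv, by simpa using hvC, fun x hx => ?_⟩, ?_, fun x hx => ?_⟩,
            cyclePermSubgraph_inv c⟩
          · rw [Equiv.Perm.inv_eq_iff_eq, hcfix x hx]
          · rw [support_inv]; omega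
          · have hcx : c (c⁻¹ x) = x := by simp
            have := hadj (c⁻¹ x) (by
              rw [support_inv] at hx
              rwa [← Equiv.Perm.apply_mem_support, hcx])
            rw [hcx] at this
            exact this.symm
    have hne : c ≠ c⁻¹ := by
      intro h
      obtain ⟨y, hy, -⟩ := id hc
      refine hc.apply_apply_ne h3 hy ?_
      nth_rewrite 1 [h]
      simp
    rw [hfiber, sum_pair hne, support_inv, hverts, Set.ncard_coe_finset, two_mul]
  · intro c hc
    simp only [cyclesThrough, mem_filter, mem_univ, true_and] at hc
    obtain ⟨⟨hc, hvc, hfix⟩, h2, hadj⟩ := hc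
    have := hc.two_le_card_support
    simp only [Set.Finite.mem_toFinset, Set.mem_ofPred_eq]
    refine ⟨isCycleSubgraph_cyclePermSubgraph hc (by omega) hadj, ?_, ?_⟩
    · rwa [hverts, mem_coe]
    · rw [← Set.disjoint_iff_inter_eq_empty, Set.disjoint_left]
      exact fun x hx hxS => hx (hfix x hxS)

end Laplacian

/-- expansion of `per L_S(G)` at a vertex `v ∉ S`. -/
theorem permDel_vertex_expansion {V : Type*} [Fintype V] (G : SimpleGraph V) (v : V)
    (S : Set V) (hS : S.Nonempty) (hSproper : S ≠ Set.univ) (hv : v ∉ S) :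
    permDel G S = (G.degree v : ℝ) * permDel G (S ∪ {v})
      + (∑ᶠ u ∈ {u | u ∈ G.neighborSet v ∧ u ∉ S}, permDel G (S ∪ {u, v}))
      + 2 * ∑ᶠ C ∈ {C : G.Subgraph |
            IsCycleSubgraph G C ∧ v ∈ C.verts ∧ C.verts ∩ S = ∅},
          (-1 : ℝ) ^ C.verts.ncard * permDel G (C.verts ∪ S) := by
  rw [permDel_eq_sum_cyclesThrough G v S hv, ← Finset.sum_filter_add_sum_filter_not _
    (fun c => c.support.card = 2), sum_cyclesThrough_two G v S hv, sum_cyclesThrough_three_le,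
    add_assoc]
end

section
/- Let G be a simple graph and let e = uv be an edge of G. Then per L_u(G) = per L_u(G−e) + per L_{uv}(G), where G−e is the graph obtained from G by deleting the edge e. -/
open scoped Classical

/-- Reindexing rows and columns by the same equivalence preserves the permanent. -/
theorem Matrix.permanent_submatrix_equiv_self {m n R : Type*} [Fintype m] [Fintype n]
    [DecidableEq m] [DecidableEq n] [CommSemiring R] (e : m ≃ n) (A : Matrix n n R) :
    (A.submatrix e e).permanent = A.permanent := by
  unfold Matrix.permanent
  refine Fintype.sum_equiv e.permCongr _ _ fun σ => ?_
  refine Fintype.prod_equiv e _ _ fun i => ?_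
  simp [Equiv.permCongr_apply]

/-- Increasing one diagonal entry by `c` increases the permanent by `c` times the permanent of
the complementary principal submatrix. -/
theorem Matrix.permanent_eq_add_of_diag {n R : Type*} [Fintype n] [DecidableEq n]
    [CommSemiring R] (A B : Matrix n n R) (v : n) (c : R) (hv : A v v = B v v + c)
    (h : ∀ i j, (i ≠ v ∨ j ≠ v) → A i j = B i j) :
    A.permanent = B.permanent +
      c * (A.submatrix (Subtype.val : {i // i ≠ v} → n) Subtype.val).permanent := by
  have key : ∀ σ : Equiv.Perm n, ∏ i, A (σ i) i = ∏ i, B (σ i) i +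
      if σ v = v then c * ∏ i : {i // i ≠ v}, A (σ i) i else 0 := by
    intro σ
    split_ifs with hσ
    · rw [Fintype.prod_eq_mul_prod_subtype_ne _ v,
        Fintype.prod_eq_mul_prod_subtype_ne (fun i => B (σ i) i) v, hσ, hv, add_mul]
      congr 2
      exact Finset.prod_congr rfl fun i _ => h _ _ (Or.inr i.2)
    · rw [add_zero]
      refine Finset.prod_congr rfl fun i _ => h _ _ ?_
      by_contra! hi
      exact hσ (hi.2 ▸ hi.1)
  unfold Matrix.permanent
  rw [Finset.sum_congr rfl fun σ _ => key σ, Finset.sum_add_distrib, Finset.mul_sum,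
    ← Finset.sum_filter]
  congr 1
  symm
  refine Finset.sum_bij (fun τ _ => Equiv.Perm.ofSubtype τ) ?_ ?_ ?_ ?_
  · intro τ _
    simp [Equiv.Perm.ofSubtype_apply_of_not_mem]
  · intro τ _ τ' _ hτ
    exact Equiv.Perm.ofSubtype_injective hτ
  · intro σ hσ
    have hσ : σ v = v := by simpa using hσ
    have hs : ∀ i, σ i ≠ v ↔ i ≠ v := fun i => by
      rw [not_iff_not]
      exact ⟨fun hi => σ.injective (hi.trans hσ.symm), fun hi => hi ▸ hσ⟩
    refine ⟨σ.subtypePerm hs, Finset.mem_univ _, Equiv.Perm.ofSubtype_subtypePerm _ ?_⟩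
    rintro i hi rfl
    exact hi hσ
  · intro τ _
    simp

/-- Deleting the edge `uv` changes the Laplacian matrix, away from row and column `u`, only by
decreasing the diagonal entry at `v` by one. -/
theorem lapMatrix_deleteEdges_apply_of_ne {V : Type*} [Fintype V] (G : SimpleGraph V) {u v : V}
    (huv : G.Adj u v) {i j : V} (hi : i ≠ u) (hj : j ≠ u) :
    G.lapMatrix ℝ i j = (G.deleteEdges {s(u, v)}).lapMatrix ℝ i j +
      if i = v ∧ j = v then 1 else 0 := by
  have hadj : (G.deleteEdges {s(u, v)}).Adj i j ↔ G.Adj i j := by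
    simp [SimpleGraph.deleteEdges_adj, hi, hj]
  have hdeg : G.degree i = (G.deleteEdges {s(u, v)}).degree i + if i = v then 1 else 0 := by
    rw [← SimpleGraph.card_neighborFinset_eq_degree, ← SimpleGraph.card_neighborFinset_eq_degree]
    split_ifs with h
    · subst h
      have hu : u ∈ G.neighborFinset i := by simpa using huv.symm
      rw [← Finset.card_erase_add_one hu]
      congr 2
      ext k
      simp only [Finset.mem_erase, SimpleGraph.mem_neighborFinset, SimpleGraph.deleteEdges_adj,
        Set.mem_singleton_iff, Sym2.eq_iff]
      grind
    · congr 1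
      ext k
      simp [SimpleGraph.deleteEdges_adj, hi, h]
  by_cases hij : i = j
  · subst hij
    simp [SimpleGraph.lapMatrix, SimpleGraph.degMatrix, hdeg]
  · have : ¬(i = v ∧ j = v) := fun h => hij (h.1.trans h.2.symm)
    simp [SimpleGraph.lapMatrix, SimpleGraph.degMatrix, hij, this, SimpleGraph.adjMatrix_apply,
      hadj, -SimpleGraph.deleteEdges_adj]

/-- `permDel` may be computed along any enumeration of the remaining vertices. -/
theorem permDel_eq_of_equiv {V m : Type*} [Fintype V] [Fintype m] [DecidableEq m]
    (G : SimpleGraph V) {S : Set V} (e : m ≃ ↥Sᶜ) :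
    permDel G S =
      ((G.lapMatrix ℝ).submatrix (fun i => (e i : V)) fun i => (e i : V)).permanent :=
  (Matrix.permanent_submatrix_equiv_self e _).symm

/-- for an edge `e = uv`, `per L_u(G) = per L_u(G−e) + per L_{uv}(G)`. -/
theorem permDel_deleteEdge {V : Type*} [Fintype V] (G : SimpleGraph V) (u v : V)
    (huv : G.Adj u v) :
    permDel G {u} = permDel (G.deleteEdges {s(u, v)}) {u} + permDel G {u, v} := by
  have hvu : v ∈ ({u}ᶜ : Set V) := huv.ne'
  let e : ↥({u, v}ᶜ : Set V) ≃ {i : ↥({u}ᶜ : Set V) // i ≠ ⟨v, hvu⟩} :=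
    { toFun := fun i => ⟨⟨i, fun h => i.2 (Or.inl h)⟩,
        fun h => i.2 (Or.inr (congrArg Subtype.val h))⟩
      invFun := fun i => ⟨i, fun h => h.elim i.1.2 fun h => i.2 (Subtype.ext h)⟩
      left_inv := fun _ => rfl
      right_inv := fun _ => rfl }
  rw [permDel_eq_of_equiv G (Equiv.refl ↥({u}ᶜ : Set V)),
    permDel_eq_of_equiv (G.deleteEdges {s(u, v)}) (Equiv.refl ↥({u}ᶜ : Set V)),
    permDel_eq_of_equiv G e.symm,
    Matrix.permanent_eq_add_of_diag _ (((G.deleteEdges {s(u, v)}).lapMatrix ℝ).submatrix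
      (fun i => (Equiv.refl ↥({u}ᶜ : Set V) i : V)) fun i => (Equiv.refl _ i : V)) ⟨v, hvu⟩ 1,
    one_mul]
  · congr!
  · simpa using lapMatrix_deleteEdges_apply_of_ne G huv hvu hvu
  · intro i j hij
    have hne : ¬((i : V) = v ∧ (j : V) = v) := fun h =>
      hij.elim (fun hi => hi (Subtype.ext h.1)) fun hj => hj (Subtype.ext h.2)
    simpa [hne] using lapMatrix_deleteEdges_apply_of_ne G huv i.2 j.2
end
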